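/- arXiv:2507.06088 — 2 statements merged into one kernel-verified Lean document; each statement's English description precedes it below -/
import Mathlib

section
/- Let W be a TPM process matrix on H_A ⊗ H_B ⊗ H_C, let d := dim H_A, and let H_{A'} ≅ H_A. Define a strategy to consist of: a family (M_x)_{x∈X}, indexed by a set X with |X| = d², of matrices on H_A ⊗ H_{A'} that are positive semidefinite with Tr_{A'} M_x = id_A and Tr_A M_x = id_{A'}; together with positive semidefinite matrices (E_y)_{y ∈ X ∪ {∅}} on H_{A'} ⊗ H_B ⊗ H_C whose sum S := ∑_y E_y satisfies S = (1/d_C)(Tr_C S) ⊗ id_C and (1/d_C) Tr_{BC} S = id_{A'}. The average success probability of a strategy is (1/d²) ∑_{x∈X} Tr[(M_x ⋆ E_x) W], where (M ⋆ E)_{(a,b,c),(ā,b̄,c̄)} := ∑_{a',a''} M_{(a,a''),(ā,a')} · E_{(a'',b,c),(a',b̄,c̄)}. Then the supremum over all strategies of the average success probability equals (1/d) · sup{ Tr(Θ W) : Θ an entanglement retriever on H_A ⊗ H_B ⊗ H_C }. -/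
open Matrix Kronecker BigOperators ComplexOrder

noncomputable section

/-- Partial trace over the second (right) tensor factor. -/
def ptrR {α : Type*} {n : ℕ} (M : Matrix (α × Fin n) (α × Fin n) ℂ) : Matrix α α ℂ :=
  Matrix.of fun i j => ∑ k, M (i, k) (j, k)

/-- Partial trace over the first (left) tensor factor. -/
def ptrL {m : ℕ} {β : Type*} (M : Matrix (Fin m × β) (Fin m × β) ℂ) : Matrix β β ℂ :=
  Matrix.of fun i j => ∑ k, M (k, i) (k, j)

/-- Partial trace over the last factor `C` of a matrix on `A ⊗ B ⊗ C`. -/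
def trC3 {a b c : ℕ} (M : Matrix (Fin a × Fin b × Fin c) (Fin a × Fin b × Fin c) ℂ) :
    Matrix (Fin a × Fin b) (Fin a × Fin b) ℂ :=
  Matrix.of fun x y => ∑ k, M (x.1, x.2, k) (y.1, y.2, k)

/-- Partial trace over the last two factors `B ⊗ C` of a matrix on `A ⊗ B ⊗ C`. -/
def trBC3 {a b c : ℕ} (M : Matrix (Fin a × Fin b × Fin c) (Fin a × Fin b × Fin c) ℂ) :
    Matrix (Fin a) (Fin a) ℂ :=
  Matrix.of fun i j => ∑ β : Fin b, ∑ γ : Fin c, M (i, β, γ) (j, β, γ)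

/-- Kronecker product of a matrix on `A ⊗ B` with a matrix on `C`,
yielding a matrix on `A ⊗ B ⊗ C`. -/
def kronABC {a b c : ℕ} (M : Matrix (Fin a × Fin b) (Fin a × Fin b) ℂ)
    (Y : Matrix (Fin c) (Fin c) ℂ) :
    Matrix (Fin a × Fin b × Fin c) (Fin a × Fin b × Fin c) ℂ :=
  Matrix.of fun x y => M (x.1, x.2.1) (y.1, y.2.1) * Y x.2.2 y.2.2

/-- The link product over `A'` of a matrix `M` on `H_A ⊗ H_{A'}` with a matrix `E` on
`H_{A'} ⊗ H_B ⊗ H_C`. -/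
def linkA {a b c : ℕ} (M : Matrix (Fin a × Fin a) (Fin a × Fin a) ℂ)
    (E : Matrix (Fin a × Fin b × Fin c) (Fin a × Fin b × Fin c) ℂ) :
    Matrix (Fin a × Fin b × Fin c) (Fin a × Fin b × Fin c) ℂ :=
  Matrix.of fun x y => ∑ a' : Fin a, ∑ a'' : Fin a,
    M (x.1, a'') (y.1, a') * E (a'', x.2) (a', y.2)

/-- An entanglement retriever. -/
def IsER {a b c : ℕ} (Θ : Matrix (Fin a × Fin b × Fin c) (Fin a × Fin b × Fin c) ℂ) : Prop :=
  Θ.PosSemidef ∧ ∃ η : Matrix (Fin b) (Fin b) ℂ, η.PosSemidef ∧ η.trace = 1 ∧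
    ((η ⊗ₖ (1 : Matrix (Fin c) (Fin c) ℂ)) - ptrL Θ).PosSemidef

/-- A valid TPM process matrix. -/
def IsTPM {a b c : ℕ} (W : Matrix (Fin a × Fin b × Fin c) (Fin a × Fin b × Fin c) ℂ) : Prop :=
  W.PosSemidef ∧ W.trace = (b : ℂ) ∧
    (b : ℂ) • trC3 W = (trBC3 W) ⊗ₖ (1 : Matrix (Fin b) (Fin b) ℂ)

lemma ptrL_posSemidef {m : ℕ} {β : Type*} [Finite β] {M : Matrix (Fin m × β) (Fin m × β) ℂ}
    (hM : M.PosSemidef) : (ptrL M).PosSemidef := by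
  have h : ptrL M = ∑ k, M.submatrix (fun i => (k, i)) (fun i => (k, i)) := by
    ext i j
    simp [ptrL, Matrix.sum_apply]
  rw [h]
  exact posSemidef_sum _ fun k _ => hM.submatrix _

lemma ptrR_posSemidef {α : Type*} [Finite α] {n : ℕ} {M : Matrix (α × Fin n) (α × Fin n) ℂ}
    (hM : M.PosSemidef) : (ptrR M).PosSemidef := by
  have h : ptrR M = ∑ k, M.submatrix (fun i => (i, k)) (fun i => (i, k)) := by
    ext i j
    simp [ptrR, Matrix.sum_apply]
  rw [h]
  exact posSemidef_sum _ fun k _ => hM.submatrix _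

lemma linkA_posSemidef {a b c : ℕ} {M : Matrix (Fin a × Fin a) (Fin a × Fin a) ℂ}
    {E : Matrix (Fin a × Fin b × Fin c) (Fin a × Fin b × Fin c) ℂ}
    (hM : M.PosSemidef) (hE : E.PosSemidef) : (linkA M E).PosSemidef := by
  have h : linkA M E = ∑ p : Fin a × Fin a, (M ⊗ₖ E).submatrix
      (fun x : Fin a × Fin b × Fin c => ((x.1, p.2), (p.2, x.2)))
      (fun x => ((x.1, p.1), (p.1, x.2))) := by
    ext x y
    simp [linkA, Matrix.sum_apply, Fintype.sum_prod_type]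
  let L : Matrix ((Fin a × Fin a) × (Fin a × Fin b × Fin c)) (Fin a × Fin b × Fin c) ℂ :=
    ∑ k : Fin a, (1 : Matrix ((Fin a × Fin a) × (Fin a × Fin b × Fin c)) _ ℂ).submatrix id
      (fun x => ((x.1, k), (k, x.2)))
  have hL : linkA M E = Lᴴ * (M ⊗ₖ E) * L := by
    rw [h, Fintype.sum_prod_type, Finset.sum_comm]
    simp only [L, Matrix.conjTranspose_sum, Matrix.sum_mul, Matrix.mul_sum,
      Matrix.conjTranspose_submatrix, Matrix.conjTranspose_one]
    rw [Finset.sum_comm]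
    refine Finset.sum_congr rfl fun i _ => Finset.sum_congr rfl fun j _ => ?_
    ext x y
    simp [Matrix.mul_apply, Matrix.one_apply]
  rw [hL]
  exact (hM.kronecker hE).conjTranspose_mul_mul_same L

lemma ptrL_linkA {a b c : ℕ} {M : Matrix (Fin a × Fin a) (Fin a × Fin a) ℂ}
    (E : Matrix (Fin a × Fin b × Fin c) (Fin a × Fin b × Fin c) ℂ) (hM : ptrL M = 1) :
    ptrL (linkA M E) = ptrL E := by
  have h (i j : Fin a) : ∑ k, M (k, i) (k, j) = if i = j then 1 else 0 := by
    simpa [ptrL, Matrix.one_apply] using congrFun (congrFun hM i) j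
  ext x y
  simp only [ptrL, linkA, Matrix.of_apply]
  rw [Finset.sum_comm]
  refine Finset.sum_congr rfl fun i _ => ?_
  rw [Finset.sum_comm]
  simp [← Finset.sum_mul, h]

/-- The Heisenberg-Weyl unitaries: a unitary operator basis with `d ^ 2` elements. -/
lemma exists_unitary_basis (d : ℕ) (hd : 0 < d) :
    ∃ u : Fin (d ^ 2) → Matrix (Fin d) (Fin d) ℂ,
      (∀ x, u x * (u x)ᴴ = 1) ∧
      ∀ i j k l, ∑ x, star (u x k i) * u x l j = if i = j ∧ k = l then (d : ℂ) else 0 := by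
  have : NeZero d := ⟨hd.ne'⟩
  have hcard : Fintype.card (Fin d × AddChar (Fin d) ℂ) = d ^ 2 := by
    rw [Fintype.card_prod, AddChar.card_eq, Fintype.card_fin, sq]
  let e : Fin (d ^ 2) ≃ Fin d × AddChar (Fin d) ℂ := (Fintype.equivFinOfCardEq hcard).symm
  let v : Fin d × AddChar (Fin d) ℂ → Matrix (Fin d) (Fin d) ℂ := fun x =>
    Matrix.of fun k i => if k = i + x.1 then x.2 i else 0
  have hconj (ψ : AddChar (Fin d) ℂ) (i : Fin d) : star (ψ i) = ψ (-i) := by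
    rw [AddChar.map_neg_eq_conj]; rfl
  refine ⟨fun x => v (e x), fun x => ?_, fun i j k l => ?_⟩
  · ext k l
    set p := (e x).1
    set ψ := (e x).2
    have hv (k i) : v (e x) k i = if k = i + p then ψ i else 0 := rfl
    simp only [hv, Matrix.mul_apply, Matrix.conjTranspose_apply]
    rw [Finset.sum_eq_single (k - p)]
    · by_cases hkl : k = l
      · subst hkl
        simp only [sub_add_cancel, if_true, hconj, ← AddChar.map_add_eq_mul]
        simp
      · simp [hkl, Ne.symm hkl]
    · intro b _ hb
      rw [if_neg (fun h => hb (by simp [h])), zero_mul]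
    · simp
  · rw [e.sum_comp (fun x => star (v x k i) * v x l j), Fintype.sum_prod_type]
    have key (p : Fin d) : ∑ ψ, star (v (p, ψ) k i) * v (p, ψ) l j =
        if k = i + p ∧ l = j + p ∧ i = j then (d : ℂ) else 0 := by
      by_cases hk : k = i + p
      · by_cases hl : l = j + p
        · have h := AddChar.sum_apply_eq_ite (j - i)
          simp only [Fintype.card_fin, sub_eq_zero] at h
          simp only [v, Matrix.of_apply, ← hk, ← hl, if_true, hconj, true_and,
            ← AddChar.map_add_eq_mul]
          simp only [neg_add_eq_sub, eq_comm (a := i) (b := j)]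
          exact h
        · simp [v, hl]
      · simp [v, hk]
    simp_rw [key]
    rw [Finset.sum_eq_single (k - i)]
    · refine if_congr ?_ rfl rfl
      constructor
      · rintro ⟨-, h, rfl⟩
        simp [h]
      · rintro ⟨rfl, rfl⟩
        simp
    · intro b _ hb
      rw [if_neg]
      rintro ⟨rfl, -⟩
      simp at hb
    · simp

lemma linkA_vecMulVec {a b c : ℕ} (u : Matrix (Fin a) (Fin a) ℂ)
    (E : Matrix (Fin a × Fin b × Fin c) (Fin a × Fin b × Fin c) ℂ) :
    linkA (vecMulVec (fun p : Fin a × Fin a => u p.1 p.2) (star fun p => u p.1 p.2)) E =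
      (u ⊗ₖ (1 : Matrix (Fin b × Fin c) (Fin b × Fin c) ℂ)) * E *
        (u ⊗ₖ (1 : Matrix (Fin b × Fin c) (Fin b × Fin c) ℂ))ᴴ := by
  rw [conjTranspose_kronecker, conjTranspose_one]
  ext x y
  simp only [linkA, vecMulVec_apply, Matrix.mul_apply, Matrix.of_apply, kroneckerMap_apply,
    conjTranspose_apply, Fintype.sum_prod_type (α₁ := Fin a) (α₂ := Fin b × Fin c),
    Matrix.one_apply, Pi.star_apply]
  simp [Finset.sum_mul]
  exact Finset.sum_congr rfl fun i _ => Finset.sum_congr rfl fun j _ => by ring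

lemma sum_conj_unitary_basis {a b c n : ℕ} {u : Fin n → Matrix (Fin a) (Fin a) ℂ}
    (hu : ∀ i j k l, ∑ x, star (u x k i) * u x l j = if i = j ∧ k = l then (a : ℂ) else 0)
    (Θ : Matrix (Fin a × Fin b × Fin c) (Fin a × Fin b × Fin c) ℂ) :
    ∑ x, (u x ⊗ₖ (1 : Matrix (Fin b × Fin c) (Fin b × Fin c) ℂ))ᴴ * Θ *
        (u x ⊗ₖ (1 : Matrix (Fin b × Fin c) (Fin b × Fin c) ℂ)) =
      (a : ℂ) • ((1 : Matrix (Fin a) (Fin a) ℂ) ⊗ₖ ptrL Θ) := by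
  ext ⟨i, s⟩ ⟨j, t⟩
  have h (x : Fin n) : ((u x ⊗ₖ (1 : Matrix (Fin b × Fin c) (Fin b × Fin c) ℂ))ᴴ * Θ *
        (u x ⊗ₖ (1 : Matrix (Fin b × Fin c) (Fin b × Fin c) ℂ))) (i, s) (j, t) =
      ∑ l, ∑ k, star (u x k i) * u x l j * Θ (k, s) (l, t) := by
    rw [conjTranspose_kronecker, conjTranspose_one]
    simp only [Matrix.mul_apply, kroneckerMap_apply, conjTranspose_apply,
      Fintype.sum_prod_type (α₁ := Fin a) (α₂ := Fin b × Fin c), Matrix.one_apply]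
    simp [Finset.sum_mul]
    exact Finset.sum_congr rfl fun i _ => Finset.sum_congr rfl fun j _ => by ring
  simp only [Matrix.sum_apply, h]
  rw [Finset.sum_comm]
  simp_rw [Finset.sum_comm (s := Finset.univ (α := Fin n)), ← Finset.sum_mul, hu]
  by_cases hij : i = j
  · simp [hij, ptrL, Finset.mul_sum]
  · simp [hij]

lemma isER_of_strategy {a b c n : ℕ} (ha : 0 < a) (hc : 0 < c)
    {M : Fin n → Matrix (Fin a × Fin a) (Fin a × Fin a) ℂ}
    {E : Option (Fin n) → Matrix (Fin a × Fin b × Fin c) (Fin a × Fin b × Fin c) ℂ}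
    (hM : ∀ x, (M x).PosSemidef) (hM' : ∀ x, ptrL (M x) = 1) (hE : ∀ y, (E y).PosSemidef)
    (hS : (∑ y, E y) = ((c : ℂ))⁻¹ • kronABC (trC3 (∑ y, E y)) (1 : Matrix (Fin c) (Fin c) ℂ))
    (hS' : ((c : ℂ))⁻¹ • trBC3 (∑ y, E y) = 1) :
    IsER ((a : ℂ)⁻¹ • ∑ x, linkA (M x) (E (some x))) := by
  have ha0 : (0 : ℂ) ≤ (a : ℂ)⁻¹ := by positivity
  have hc0 : (0 : ℂ) ≤ (c : ℂ)⁻¹ := by positivity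
  have ha1 : (a : ℂ) ≠ 0 := by exact_mod_cast ha.ne'
  have hsum : (∑ y, E y).PosSemidef := posSemidef_sum _ fun y _ => hE y
  refine ⟨(posSemidef_sum _ fun x _ => linkA_posSemidef (hM x) (hE _)).smul ha0,
    (a : ℂ)⁻¹ • (c : ℂ)⁻¹ • ptrR (ptrL (∑ y, E y)),
    ((ptrR_posSemidef (ptrL_posSemidef hsum)).smul hc0).smul ha0, ?_, ?_⟩
  · have h := congrArg Matrix.trace hS'
    rw [trace_smul, trace_one, Fintype.card_fin] at h
    rw [trace_smul, trace_smul]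
    have h2 : (ptrR (ptrL (∑ y, E y))).trace = (trBC3 (∑ y, E y)).trace := by
      simp only [trace, ptrR, ptrL, trBC3, diag_apply, of_apply]
      simp_rw [Finset.sum_comm (s := Finset.univ (α := Fin c)) (t := Finset.univ (α := Fin a))]
      exact Finset.sum_comm
    rw [h2, h, smul_eq_mul, inv_mul_cancel₀ ha1]
  · set S := ∑ y, E y with hSdef
    have h1 : ((a : ℂ)⁻¹ • (c : ℂ)⁻¹ • ptrR (ptrL S)) ⊗ₖ (1 : Matrix (Fin c) (Fin c) ℂ) =
        (a : ℂ)⁻¹ • ptrL S := by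
      rw [smul_kronecker]
      congr 1
      conv_rhs => rw [hS]
      ext x y
      simp only [kroneckerMap_apply, Matrix.smul_apply, ptrR, ptrL, of_apply, kronABC, trC3, smul_eq_mul,
        Finset.mul_sum, Finset.sum_mul]
      rw [Finset.sum_comm]
      exact Finset.sum_congr rfl fun i _ => Finset.sum_congr rfl fun j _ => by ring
    have h2 : ptrL ((a : ℂ)⁻¹ • ∑ x, linkA (M x) (E (some x))) =
        (a : ℂ)⁻¹ • ∑ x, ptrL (E (some x)) := by
      simp_rw [← fun x => ptrL_linkA (E (some x)) (hM' x)]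
      ext x y
      simp only [ptrL, Matrix.smul_apply, Matrix.sum_apply, of_apply, ← Finset.smul_sum]
      rw [Finset.sum_comm]
    have h3 : ptrL S = ptrL (E none) + ∑ x, ptrL (E (some x)) := by
      rw [hSdef, Fintype.sum_option]
      ext x y
      simp only [ptrL, Matrix.add_apply, Matrix.sum_apply, of_apply, Finset.sum_add_distrib]
      rw [Finset.sum_comm]
    rw [h1, h2, h3, smul_add, add_sub_cancel_right]
    exact (ptrL_posSemidef (hE none)).smul ha0

lemma exists_strategy_of_isER {a b c : ℕ} (ha : 0 < a) (hc : 0 < c)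
    {Θ : Matrix (Fin a × Fin b × Fin c) (Fin a × Fin b × Fin c) ℂ} (hΘ : IsER Θ) :
    ∃ (M : Fin (a ^ 2) → Matrix (Fin a × Fin a) (Fin a × Fin a) ℂ)
      (E : Option (Fin (a ^ 2)) → Matrix (Fin a × Fin b × Fin c) (Fin a × Fin b × Fin c) ℂ),
      (∀ x, (M x).PosSemidef ∧ ptrR (M x) = 1 ∧ ptrL (M x) = 1) ∧
      (∀ y, (E y).PosSemidef) ∧
      (∑ y, E y) = ((c : ℂ))⁻¹ • kronABC (trC3 (∑ y, E y)) (1 : Matrix (Fin c) (Fin c) ℂ) ∧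
      ((c : ℂ))⁻¹ • trBC3 (∑ y, E y) = 1 ∧
      ∀ x, linkA (M x) (E (some x)) = (a : ℂ)⁻¹ • Θ := by
  obtain ⟨hpos, η, hη, htr, hle⟩ := hΘ
  obtain ⟨u, hu, hu'⟩ := exists_unitary_basis a ha
  have ha0 : (0 : ℂ) ≤ (a : ℂ)⁻¹ := by positivity
  have ha1 : (a : ℂ) ≠ 0 := by exact_mod_cast ha.ne'
  have hc1 : (c : ℂ) ≠ 0 := by exact_mod_cast hc.ne'
  let K : Fin (a ^ 2) → Matrix (Fin a × Fin b × Fin c) (Fin a × Fin b × Fin c) ℂ := fun x =>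
    u x ⊗ₖ (1 : Matrix (Fin b × Fin c) (Fin b × Fin c) ℂ)
  have hK (x) : K x * (K x)ᴴ = 1 := by
    simp only [K]
    rw [conjTranspose_kronecker, ← mul_kronecker_mul, hu, conjTranspose_one, mul_one,
      one_kronecker_one]
  let E : Option (Fin (a ^ 2)) → Matrix (Fin a × Fin b × Fin c) (Fin a × Fin b × Fin c) ℂ :=
    fun y => y.elim ((1 : Matrix (Fin a) (Fin a) ℂ) ⊗ₖ (η ⊗ₖ (1 : Matrix (Fin c) (Fin c) ℂ) - ptrL Θ))
      fun x => (a : ℂ)⁻¹ • ((K x)ᴴ * Θ * K x)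
  have hsum : ∑ y, E y =
      (1 : Matrix (Fin a) (Fin a) ℂ) ⊗ₖ (η ⊗ₖ (1 : Matrix (Fin c) (Fin c) ℂ)) := by
    rw [Fintype.sum_option]
    simp only [E, Option.elim, ← Finset.smul_sum, K]
    rw [sum_conj_unitary_basis hu', smul_smul, inv_mul_cancel₀ ha1, one_smul, ← kronecker_add,
      sub_add_cancel]
  have hent (i i' j j' k k') : (∑ y, E y) (i, j, k) (i', j', k') =
      (1 : Matrix (Fin a) (Fin a) ℂ) i i' * (η j j' * (1 : Matrix (Fin c) (Fin c) ℂ) k k') := by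
    rw [hsum]
    rfl
  refine ⟨fun x => vecMulVec (fun p : Fin a × Fin a => u x p.1 p.2) (star fun p => u x p.1 p.2), E,
    fun x => ⟨posSemidef_vecMulVec_self_star _, ?_, ?_⟩, ?_, ?_, ?_, fun x => ?_⟩
  · rw [← hu x]
    ext i j
    simp [ptrR, vecMulVec_apply, Matrix.mul_apply]
  · have h := congrArg Matrix.transpose (mul_eq_one_comm.mp (hu x))
    rw [transpose_one] at h
    rw [← h]
    ext i j
    simp [ptrL, vecMulVec_apply, Matrix.mul_apply, mul_comm]
  · rintro (_ | x)
    · exact PosSemidef.one.kronecker hle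
    · exact (hpos.conjTranspose_mul_mul_same (K x)).smul ha0
  · ext ⟨i, j, k⟩ ⟨i', j', k'⟩
    simp only [kronABC, trC3, Matrix.smul_apply, of_apply, hent, Matrix.one_apply_eq, smul_eq_mul,
      mul_one, Finset.sum_const, Finset.card_univ, Fintype.card_fin, nsmul_eq_mul]
    field_simp
  · ext i j
    have h : ∑ k, η k k = 1 := htr
    simp only [trBC3, Matrix.smul_apply, of_apply, hent, Matrix.one_apply_eq, smul_eq_mul,
      mul_one, Finset.sum_const, Finset.card_univ, Fintype.card_fin, nsmul_eq_mul,
      ← Finset.mul_sum, h]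
    field_simp
  · rw [linkA_vecMulVec]
    change K x * ((a : ℂ)⁻¹ • ((K x)ᴴ * Θ * K x)) * (K x)ᴴ = _
    rw [Matrix.mul_smul, Matrix.smul_mul, ← Matrix.mul_assoc, ← Matrix.mul_assoc, hK, one_mul,
      Matrix.mul_assoc, hK, mul_one]

/-- **Observation 3.** The supremum over all encoding-decoding strategies of
the average success probability equals `(1/d) · sup { Tr(Θ W) : Θ an entanglement
retriever }`. -/
theorem stmt8 (dA dB dC : ℕ) (hdA : 0 < dA) (hdB : 0 < dB) (hdC : 0 < dC)
    (W : Matrix (Fin dA × Fin dB × Fin dC) (Fin dA × Fin dB × Fin dC) ℂ)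
    (hW : IsTPM W) :
    sSup {r : ℝ |
      ∃ (M : Fin (dA ^ 2) → Matrix (Fin dA × Fin dA) (Fin dA × Fin dA) ℂ)
        (E : Option (Fin (dA ^ 2)) →
          Matrix (Fin dA × Fin dB × Fin dC) (Fin dA × Fin dB × Fin dC) ℂ),
        (∀ x, (M x).PosSemidef ∧ ptrR (M x) = 1 ∧ ptrL (M x) = 1) ∧
        (∀ y, (E y).PosSemidef) ∧
        (∑ y, E y) =
          ((dC : ℂ))⁻¹ • kronABC (trC3 (∑ y, E y)) (1 : Matrix (Fin dC) (Fin dC) ℂ) ∧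
        ((dC : ℂ))⁻¹ • trBC3 (∑ y, E y) = 1 ∧
        r = (1 / (dA ^ 2 : ℝ)) * (∑ x : Fin (dA ^ 2), (linkA (M x) (E (some x)) * W).trace).re}
    = (1 / (dA : ℝ)) *
      sSup {r : ℝ | ∃ Θ : Matrix (Fin dA × Fin dB × Fin dC) (Fin dA × Fin dB × Fin dC) ℂ,
        IsER Θ ∧ r = ((Θ * W).trace).re} := by
  have hd : (dA : ℝ) ≠ 0 := by exact_mod_cast hdA.ne'
  rw [← smul_eq_mul, ← Real.sSup_smul_of_nonneg (by positivity)]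
  congr 1
  ext r
  simp only [Set.mem_ofPred_eq, Set.mem_smul_set]
  constructor
  · rintro ⟨M, E, hM, hE, hS, hS', rfl⟩
    refine ⟨_, ⟨_, isER_of_strategy hdA hdC (fun x => (hM x).1) (fun x => (hM x).2.2) hE hS hS',
      rfl⟩, ?_⟩
    rw [Matrix.smul_mul, trace_smul, Matrix.sum_mul, trace_sum, smul_eq_mul, smul_eq_mul,
      ← Complex.ofReal_natCast, ← Complex.ofReal_inv, Complex.re_ofReal_mul]
    field_simp
  · rintro ⟨_, ⟨Θ, hΘ, rfl⟩, rfl⟩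
    obtain ⟨M, E, hM, hE, hS, hS', hl⟩ := exists_strategy_of_isER hdA hdC hΘ
    refine ⟨M, E, hM, hE, hS, hS', ?_⟩
    simp_rw [hl, Matrix.smul_mul, trace_smul]
    rw [Finset.sum_const, Finset.card_univ, Fintype.card_fin, smul_eq_mul, smul_eq_mul,
      nsmul_eq_mul, ← Complex.ofReal_natCast, ← Complex.ofReal_natCast, ← Complex.ofReal_inv,
      Complex.re_ofReal_mul, Complex.re_ofReal_mul]
    push_cast
    field_simp
end
end

section
/- Let Z be a Hermitian matrix on H_A ⊗ H_B ⊗ H_C and let σ be a density matrix on H_A. Then there exists ε > 0 such that for every real β with |β| ≤ ε, the matrix Θ_β := id/(d_A · d_B) − β · (Z − σ ⊗ Tr_A Z) is positive semidefinite and satisfies Tr_A Θ_β = (1/d_B) · id_{B⊗C}; in particular Θ_β is an entanglement retriever. -/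
open Matrix Kronecker BigOperators ComplexOrder

noncomputable section

open scoped MatrixOrder Matrix.Norms.L2Operator in
/-- A positive multiple of the identity stays positive semidefinite under every sufficiently
small multiple of a Hermitian perturbation. -/
lemma Matrix.IsHermitian.exists_posSemidef_smul_one_sub_smul {n : Type*} [Fintype n]
    [DecidableEq n] {K : Matrix n n ℂ} (hK : K.IsHermitian) {c : ℝ} (hc : 0 < c) :
    ∃ ε : ℝ, 0 < ε ∧ ∀ β : ℝ, |β| ≤ ε →
      ((c : ℂ) • (1 : Matrix n n ℂ) - (β : ℂ) • K).PosSemidef := by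
  have hpos : 0 < ‖K‖ + 1 := by positivity
  refine ⟨c / (‖K‖ + 1), by positivity, fun β hβ => ?_⟩
  have hsa : IsSelfAdjoint ((β : ℂ) • K) :=
    IsSelfAdjoint.smul (Complex.conj_ofReal β) hK
  have hnorm : ‖(β : ℂ) • K‖ ≤ c := by
    rw [norm_smul, Complex.norm_real, Real.norm_eq_abs]
    rw [le_div_iff₀ hpos] at hβ
    nlinarith [abs_nonneg β]
  rw [← Matrix.le_iff]
  calc (β : ℂ) • K ≤ algebraMap ℝ (Matrix n n ℂ) ‖(β : ℂ) • K‖ := hsa.le_algebraMap_norm_self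
    _ ≤ algebraMap ℝ (Matrix n n ℂ) c := algebraMap_mono _ hnorm
    _ = (c : ℂ) • 1 := by rw [Algebra.algebraMap_eq_smul_one, Complex.coe_smul]

lemma Matrix.IsHermitian.ptrL {m : ℕ} {β : Type*}
    {M : Matrix (Fin m × β) (Fin m × β) ℂ} (hM : M.IsHermitian) : (ptrL M).IsHermitian := by
  ext i j
  simp only [_root_.ptrL, conjTranspose_apply, of_apply, star_sum]
  exact Finset.sum_congr rfl fun k _ => hM.apply _ _

lemma Matrix.IsHermitian.kronecker {m n : Type*} {A : Matrix m m ℂ} {B : Matrix n n ℂ}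
    (hA : A.IsHermitian) (hB : B.IsHermitian) : (A ⊗ₖ B).IsHermitian := by
  rw [IsHermitian, conjTranspose_kronecker, hA.eq, hB.eq]

lemma ptrL_sub {m : ℕ} {β : Type*} (M N : Matrix (Fin m × β) (Fin m × β) ℂ) :
    ptrL (M - N) = ptrL M - ptrL N := by
  ext i j
  simp [ptrL]

lemma ptrL_smul {m : ℕ} {β : Type*} (c : ℂ) (M : Matrix (Fin m × β) (Fin m × β) ℂ) :
    ptrL (c • M) = c • ptrL M := by
  ext i j
  simp [ptrL, Finset.mul_sum]

lemma ptrL_one {m : ℕ} {β : Type*} [DecidableEq β] :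
    ptrL (1 : Matrix (Fin m × β) (Fin m × β) ℂ) = (m : ℂ) • 1 := by
  ext i j
  simp [ptrL, Matrix.one_apply]

lemma ptrL_kronecker {m : ℕ} {β : Type*} (A : Matrix (Fin m) (Fin m) ℂ) (B : Matrix β β ℂ) :
    ptrL (A ⊗ₖ B) = A.trace • B := by
  ext i j
  simp [ptrL, Matrix.trace, Finset.sum_mul]

/-- A positive semidefinite matrix whose left partial trace is the identity divided by the
dimension of the middle factor is an entanglement retriever. -/
lemma Matrix.PosSemidef.isER_of_ptrL_eq {a b c : ℕ} (hb : 0 < b)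
    {Θ : Matrix (Fin a × Fin b × Fin c) (Fin a × Fin b × Fin c) ℂ} (hΘ : Θ.PosSemidef)
    (h : ptrL Θ = (b : ℂ)⁻¹ • 1) : IsER Θ := by
  have hb' : (b : ℂ) ≠ 0 := by exact_mod_cast hb.ne'
  refine ⟨hΘ, (b : ℂ)⁻¹ • 1, PosSemidef.one.smul (by positivity), by simp [hb'], ?_⟩
  rw [h, smul_kronecker, one_kronecker_one, sub_self]
  exact PosSemidef.zero

/-- Perturbing the maximally mixed operator by a small multiple of
`Z − σ ⊗ Tr_A Z` yields an entanglement retriever with `Tr_A Θ_β = id/(d_B)`. -/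
theorem stmt12 (dA dB dC : ℕ) (hdA : 0 < dA) (hdB : 0 < dB)
    (Z : Matrix (Fin dA × Fin dB × Fin dC) (Fin dA × Fin dB × Fin dC) ℂ)
    (hZ : Z.IsHermitian)
    (σ : Matrix (Fin dA) (Fin dA) ℂ) (hσ : σ.PosSemidef ∧ σ.trace = 1) :
    ∃ ε : ℝ, 0 < ε ∧ ∀ β : ℝ, |β| ≤ ε →
      ((((dA * dB : ℕ) : ℂ))⁻¹ • (1 : Matrix (Fin dA × Fin dB × Fin dC)
          (Fin dA × Fin dB × Fin dC) ℂ) - (β : ℂ) • (Z - σ ⊗ₖ ptrL Z)).PosSemidef ∧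
      ptrL ((((dA * dB : ℕ) : ℂ))⁻¹ • (1 : Matrix (Fin dA × Fin dB × Fin dC)
          (Fin dA × Fin dB × Fin dC) ℂ) - (β : ℂ) • (Z - σ ⊗ₖ ptrL Z)) =
        ((dB : ℂ))⁻¹ • (1 : Matrix (Fin dB × Fin dC) (Fin dB × Fin dC) ℂ) ∧
      IsER ((((dA * dB : ℕ) : ℂ))⁻¹ • (1 : Matrix (Fin dA × Fin dB × Fin dC)
          (Fin dA × Fin dB × Fin dC) ℂ) - (β : ℂ) • (Z - σ ⊗ₖ ptrL Z)) := by
  obtain ⟨hσ, hσ_trace⟩ := hσ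
  have hA : (dA : ℂ) ≠ 0 := by exact_mod_cast hdA.ne'
  have hc : (0 : ℝ) < ((dA * dB : ℕ) : ℝ)⁻¹ := by positivity
  obtain ⟨ε, hε, h⟩ :=
    (hZ.sub (hσ.isHermitian.kronecker hZ.ptrL)).exists_posSemidef_smul_one_sub_smul hc
  refine ⟨ε, hε, fun β hβ => ?_⟩
  have hpsd := h β hβ
  rw [Complex.ofReal_inv, Complex.ofReal_natCast] at hpsd
  have htr : ptrL ((((dA * dB : ℕ) : ℂ))⁻¹ • (1 : Matrix (Fin dA × Fin dB × Fin dC)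
      (Fin dA × Fin dB × Fin dC) ℂ) - (β : ℂ) • (Z - σ ⊗ₖ ptrL Z)) = (dB : ℂ)⁻¹ • 1 := by
    rw [ptrL_sub, ptrL_smul, ptrL_smul, ptrL_sub, ptrL_one, ptrL_kronecker, hσ_trace, one_smul,
      sub_self, smul_zero, sub_zero, smul_smul]
    congr 1
    push_cast
    field_simp
  exact ⟨hpsd, htr, hpsd.isER_of_ptrL_eq hdB htr⟩
end
end
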